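/- For every H and H̃ in 𝒰(K), the elements H and H̃ are at distance ≤ 2ν−1 in the graph on 𝒰(K). (Via the canonical graph-compatible bijection between 𝒰(K) and the flag manifold ℬ_K over the semifield K, this is the statement that any two points of ℬ_K are at distance ≤ 2ν−1 in the graph whose edges join two distinct points lying on a common half i-circle.) -/

import Mathlib

open FreeMonoid

/-- The minimum of two elements of an additive subgroup of `ℝ`
(the "sum" in the tropical semifield `K`). -/
noncomputable def kmin {K : AddSubgroup ℝ} (a b : K) : K :=
  if (a : ℝ) ≤ (b : ℝ) then a else b

/-- Defining relations of the monoid `𝔘(K)` attached to a simply laced Coxeter matrix `M`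
and the tropical semifield `K` (a subgroup of `(ℝ, +)` with sum `min` and product `+`). -/
inductive UKRel {I : Type*} (M : CoxeterMatrix I) (K : AddSubgroup ℝ) :
    FreeMonoid (I × K) → FreeMonoid (I × K) → Prop
  | comm (i j : I) (h : M i j = 2) (a b : K) :
      UKRel M K (of (i, a) * of (j, b)) (of (j, b) * of (i, a))
  | braid (i j : I) (h : M i j = 3) (a b c : K) :
      UKRel M K (of (i, a) * of (j, b) * of (i, c))
        (of (j, b + c - kmin a c) * of (i, kmin a c) * of (j, a + b - kmin a c))
  | idem (i : I) (a b : K) :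
      UKRel M K (of (i, a) * of (i, b)) (of (i, kmin a b))

/-- The monoid `𝔘(K)`. -/
noncomputable def UK {I : Type*} (M : CoxeterMatrix I) (K : AddSubgroup ℝ) :=
  (conGen (UKRel M K)).Quotient

noncomputable instance {I : Type*} (M : CoxeterMatrix I) (K : AddSubgroup ℝ) :
    Monoid (UK M K) := Con.monoid _

/-- The generator `i^a` of `𝔘(K)`. -/
noncomputable def genU {I : Type*} (M : CoxeterMatrix I) (K : AddSubgroup ℝ)
    (i : I) (a : K) : UK M K :=
  (Con.mk' _) (of (i, a))

/-- The product `i₁^{a₁} ⋯ i_n^{a_n}` in `𝔘(K)` associated to a list of pairs. -/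
noncomputable def prodU {I : Type*} (M : CoxeterMatrix I) (K : AddSubgroup ℝ)
    (ω : List (I × K)) : UK M K :=
  (ω.map fun p => genU M K p.1 p.2).prod

/-- `l` is a reduced word of `w`. -/
def IsRedWord {I W : Type*} [Group W] {M : CoxeterMatrix I} (cs : CoxeterSystem M W)
    (w : W) (l : List I) : Prop :=
  cs.wordProd l = w ∧ l.length = cs.length w

/-- The set `𝒰(K) = 𝔘_{w₀}(K)` of products over reduced words of `w₀`. -/
noncomputable def calU {I W : Type*} [Group W] (M : CoxeterMatrix I) (K : AddSubgroup ℝ)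
    (cs : CoxeterSystem M W) (w₀ : W) : Set (UK M K) :=
  {u | ∃ ω : List (I × K), IsRedWord cs w₀ (ω.map Prod.fst) ∧ u = prodU M K ω}

/-- The set `𝒰(K₊)`: products over reduced words of `w₀` with coefficients in `K₊ = K ∩ ℝ≥0`. -/
noncomputable def calUplus {I W : Type*} [Group W] (M : CoxeterMatrix I) (K : AddSubgroup ℝ)
    (cs : CoxeterSystem M W) (w₀ : W) : Set (UK M K) :=
  {u | ∃ ω : List (I × K), IsRedWord cs w₀ (ω.map Prod.fst) ∧
        (∀ p ∈ ω, 0 ≤ (p.2 : ℝ)) ∧ u = prodU M K ω}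

/-- Two vertices of the graph on `𝒰(K)` are joined by an edge. -/
noncomputable def UEdge {I W : Type*} [Group W] (M : CoxeterMatrix I) (K : AddSubgroup ℝ)
    (cs : CoxeterSystem M W) (w₀ : W) (H H' : UK M K) : Prop :=
  H ≠ H' ∧ ∃ (i : I) (b b' : K) (ω : List (I × K)),
    IsRedWord cs w₀ (i :: ω.map Prod.fst) ∧
    H = genU M K i b * prodU M K ω ∧ H' = genU M K i b' * prodU M K ω

/-- `H` and `H'` are at distance `≤ k` in the graph on `𝒰(K)`. -/
noncomputable def DistLE {I W : Type*} [Group W] (M : CoxeterMatrix I) (K : AddSubgroup ℝ)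
    (cs : CoxeterSystem M W) (w₀ : W) (k : ℕ) (H H' : UK M K) : Prop :=
  ∃ f : ℕ → UK M K, f 0 = H ∧ f k = H' ∧ (∀ t ≤ k, f t ∈ calU M K cs w₀) ∧
    ∀ t < k, f t = f (t + 1) ∨ UEdge M K cs w₀ (f t) (f (t + 1))

namespace CoxeterSystem

variable {I W : Type*} [Group W] {M : CoxeterMatrix I} (cs : CoxeterSystem M W)

theorem functionEnd_mul_apply {α : Type*} (f g : Function.End α) (x : α) :
    (f * g) x = f (g x) := rfl

theorem functionEnd_one_apply {α : Type*} (x : α) : (1 : Function.End α) x = x := rfl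

/-! ### Distinctness of the simple reflections -/

open Classical in
/-- The action of a simple reflection on integer-valued functions on the simple roots. -/
noncomputable def reflectCoord (M : CoxeterMatrix I) (i : I) : Function.End (I → ℤ) := fun f k =>
  if k = i then - f i else if M i k = 3 then f k + f i else f k

theorem isLiftable_reflectCoord (hM : ∀ i j : I, i ≠ j → M i j = 2 ∨ M i j = 3) :
    M.IsLiftable (reflectCoord M) := by
  intro i j
  by_cases hij : i = j
  · subst hij
    rw [M.diagonal, pow_one]
    funext f k
    simp only [functionEnd_mul_apply, reflectCoord, functionEnd_one_apply]
    split_ifs <;> simp_all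
  · have hji : M j i = M i j := M.symmetric _ _
    have hij' : j ≠ i := Ne.symm hij
    rcases hM i j hij with h | h
    · rw [h]
      funext f k
      simp only [pow_succ, pow_zero, one_mul, functionEnd_mul_apply, functionEnd_one_apply]
      by_cases hki : k = i <;> by_cases hkj : k = j <;> by_cases h1 : M i k = 3 <;>
        by_cases h2 : M j k = 3 <;>
        simp_all [reflectCoord] <;> ring
    · rw [h]
      funext f k
      simp only [pow_succ, pow_zero, one_mul, functionEnd_mul_apply, functionEnd_one_apply]
      by_cases hki : k = i <;> by_cases hkj : k = j <;> by_cases h1 : M i k = 3 <;>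
        by_cases h2 : M j k = 3 <;>
        simp_all [reflectCoord] <;> ring

theorem simple_injective_of_simplyLaced (hM : ∀ i j : I, i ≠ j → M i j = 2 ∨ M i j = 3) :
    Function.Injective cs.simple := by
  intro i j h
  by_contra hij
  have key := congrArg (fun w => cs.lift ⟨_, isLiftable_reflectCoord hM⟩ w (fun _ => 1) i) h
  simp only [lift_apply_simple, reflectCoord, if_true, hij, if_false] at key
  split_ifs at key <;> omega

theorem simple_comm {i j : I} (h : M i j = 2) :
    cs.simple i * cs.simple j = cs.simple j * cs.simple i := by
  have hp := cs.simple_mul_simple_pow i j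
  rw [h] at hp
  have := congrArg (fun x => x * cs.simple j * cs.simple i) hp
  simpa [pow_succ, mul_assoc] using this

theorem simple_braid {i j : I} (h : M i j = 3) (x : W) :
    cs.simple i * (cs.simple j * (cs.simple i * x)) =
      cs.simple j * (cs.simple i * (cs.simple j * x)) := by
  have hp := cs.simple_mul_simple_pow i j
  rw [h] at hp
  have := congrArg (fun y => y * cs.simple j * cs.simple i * cs.simple j * x) hp
  simpa [pow_succ, mul_assoc] using this

/-! ### The exchange property -/

open Classical in
/-- Equality of two elements of `W`, as a Boolean. -/
noncomputable def eqBool (a b : W) : Bool := decide (a = b)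

theorem eqBool_conj (i : I) (t u : W) :
    eqBool (cs.simple i * t * cs.simple i) u = eqBool t (cs.simple i * u * cs.simple i) := by
  have : cs.simple i * t * cs.simple i = u ↔ t = cs.simple i * u * cs.simple i := by
    constructor <;> rintro rfl <;> simp [mul_assoc]
  exact Bool.eq_iff_iff.2 (by simpa only [eqBool, decide_eq_true_eq] using this)

/-- The action of a simple reflection on pairs of a group element and a sign. -/
noncomputable def signedConj (i : I) : Function.End (W × Bool) := fun p =>
  (cs.simple i * p.1 * cs.simple i, xor p.2 (eqBool p.1 (cs.simple i)))

theorem isLiftable_signedConj (hM : ∀ i j : I, i ≠ j → M i j = 2 ∨ M i j = 3) :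
    M.IsLiftable cs.signedConj := by
  intro i j
  by_cases hij : i = j
  · subst hij
    rw [M.diagonal, pow_one]
    funext ⟨t, e⟩
    simp only [functionEnd_mul_apply, signedConj, functionEnd_one_apply, eqBool_conj,
      simple_mul_simple_self, one_mul]
    generalize eqBool t (cs.simple i) = x
    cases e <;> cases x <;> simp [mul_assoc]
  · rcases hM i j hij with h | h
    · rw [h]
      have hc := cs.simple_comm h
      funext ⟨t, e⟩
      have hc' : ∀ x, cs.simple i * (cs.simple j * x) = cs.simple j * (cs.simple i * x) := by
        intro x; rw [← mul_assoc, hc, mul_assoc]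
      simp only [pow_succ, pow_zero, one_mul, functionEnd_mul_apply,
        signedConj, functionEnd_one_apply, eqBool_conj]
      simp only [mul_assoc, hc, hc', simple_mul_simple_cancel_left, simple_mul_simple_self, one_mul,
        mul_one]
      generalize eqBool t (cs.simple i) = x
      generalize eqBool t (cs.simple j) = y
      cases e <;> cases x <;> cases y <;> rfl
    · rw [h]
      have hc' := cs.simple_braid h
      have hc : cs.simple i * (cs.simple j * cs.simple i) =
          cs.simple j * (cs.simple i * cs.simple j) := by simpa using hc' 1
      funext ⟨t, e⟩
      simp only [pow_succ, pow_zero, one_mul, functionEnd_mul_apply,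
        signedConj, functionEnd_one_apply, eqBool_conj]
      simp only [mul_assoc, hc, hc', simple_mul_simple_cancel_left, simple_mul_simple_self, one_mul,
        mul_one]
      generalize eqBool t (cs.simple i) = x
      generalize eqBool t (cs.simple j) = y
      generalize eqBool t _ = z
      cases e <;> cases x <;> cases y <;> cases z <;> rfl

theorem exists_eraseIdx_of_lift_ne (hM : ∀ i j : I, i ≠ j → M i j = 2 ∨ M i j = 3)
    (ω : List I) : ∀ (t : W) (e : Bool),
      (cs.lift ⟨_, cs.isLiftable_signedConj hM⟩ (cs.wordProd ω)⁻¹ (t, e)).2 ≠ e →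
      ∃ k < ω.length, t * cs.wordProd ω = cs.wordProd (ω.eraseIdx k) := by
  induction ω with
  | nil => intro t e h; simp [functionEnd_one_apply] at h
  | cons i ω ih =>
    intro t e h
    by_cases ht : t = cs.simple i
    · exact ⟨0, by simp, by simp [ht, wordProd_cons]⟩
    · rw [wordProd_cons, mul_inv_rev, map_mul, inv_simple, lift_apply_simple,
        functionEnd_mul_apply] at h
      simp only [signedConj, eqBool, ht, decide_false, Bool.xor_false] at h
      obtain ⟨k, hk, he⟩ := ih _ _ h
      refine ⟨k + 1, by simpa using hk, ?_⟩
      rw [List.eraseIdx_cons_succ, wordProd_cons, wordProd_cons, ← he]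
      simp [mul_assoc]

/-- The exchange property. -/
theorem IsLeftDescent.exists_eraseIdx (hM : ∀ i j : I, i ≠ j → M i j = 2 ∨ M i j = 3)
    {ω : List I} {j : I} (h : cs.IsLeftDescent (cs.wordProd ω) j) :
    ∃ k < ω.length, cs.simple j * cs.wordProd ω = cs.wordProd (ω.eraseIdx k) := by
  apply cs.exists_eraseIdx_of_lift_ne hM ω _ true
  intro h1
  obtain ⟨ω', hr, hω'⟩ := cs.exists_isReduced (cs.simple j * cs.wordProd ω)
  obtain ⟨k, hk, he⟩ := cs.exists_eraseIdx_of_lift_ne hM ω' (cs.simple j) false (by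
    rw [← hω', mul_inv_rev, map_mul, inv_simple, lift_apply_simple, functionEnd_mul_apply]
    simp [signedConj, eqBool, h1])
  rw [← hω', simple_mul_simple_cancel_left] at he
  have h2 := cs.length_wordProd_le (ω'.eraseIdx k)
  rw [← he, List.length_eraseIdx_of_lt hk] at h2
  have h3 : cs.length (cs.wordProd ω') = ω'.length := hr
  rw [← hω'] at h3
  have h4 : cs.length (cs.simple j * cs.wordProd ω) < cs.length (cs.wordProd ω) := h
  omega

theorem exists_eq_simple_mul_simple_mul (hM : ∀ i j : I, i ≠ j → M i j = 2 ∨ M i j = 3)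
    {w : W} {i j : I} (hij : i ≠ j) (hi : cs.IsLeftDescent w i) (hj : cs.IsLeftDescent w j) :
    ∃ x, w = cs.simple j * (cs.simple i * x) ∧ cs.length w = cs.length x + 2 := by
  obtain ⟨ω, hr, hω⟩ := cs.exists_isReduced (cs.simple i * w)
  have hw : cs.wordProd (i :: ω) = w := by
    rw [wordProd_cons, ← hω, simple_mul_simple_cancel_left]
  rw [← hw] at hj
  obtain ⟨k, hk, he⟩ := IsLeftDescent.exists_eraseIdx cs hM hj
  rw [hw] at he
  cases k with
  | zero =>
    simp only [List.eraseIdx_cons_zero, ← hω, mul_left_inj] at he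
    exact absurd (cs.simple_injective_of_simplyLaced hM he).symm hij
  | succ k =>
    rw [List.eraseIdx_cons_succ, wordProd_cons] at he
    have hk' : k < ω.length := by simpa using hk
    have hx : w = cs.simple j * (cs.simple i * cs.wordProd (ω.eraseIdx k)) := by
      rw [← he, simple_mul_simple_cancel_left]
    refine ⟨_, hx, ?_⟩
    have h1 := cs.length_wordProd_le (ω.eraseIdx k)
    rw [List.length_eraseIdx_of_lt hk'] at h1
    have h2 : cs.length (cs.wordProd ω) = ω.length := hr
    rw [← hω] at h2
    have h3 := (cs.isLeftDescent_iff).1 hi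
    have h4 := cs.length_simple_mul (cs.simple i * cs.wordProd (ω.eraseIdx k)) j
    have h5 := cs.length_simple_mul (cs.wordProd (ω.eraseIdx k)) i
    rw [← hx] at h4
    omega

theorem exists_eq_simple_mul_simple_mul_simple_mul
    (hM : ∀ i j : I, i ≠ j → M i j = 2 ∨ M i j = 3)
    {w : W} {i j : I} (hij : i ≠ j) (h3 : M i j = 3)
    (hi : cs.IsLeftDescent w i) (hj : cs.IsLeftDescent w j) :
    ∃ x, w = cs.simple i * (cs.simple j * (cs.simple i * x)) ∧
      cs.length w = cs.length x + 3 := by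
  obtain ⟨x, hx, hl⟩ := cs.exists_eq_simple_mul_simple_mul hM hij.symm hj hi
  obtain ⟨ω, hr, hω⟩ := cs.exists_isReduced x
  have hw : cs.wordProd (i :: j :: ω) = w := by rw [wordProd_cons, wordProd_cons, ← hω, hx]
  rw [← hw] at hj
  obtain ⟨k, hk, he⟩ := IsLeftDescent.exists_eraseIdx cs hM hj
  rw [hw] at he
  have hne : cs.simple i ≠ cs.simple j := fun h => hij (cs.simple_injective_of_simplyLaced hM h)
  have hb := cs.simple_braid h3
  have hx0 : cs.length (cs.wordProd ω) = ω.length := hr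
  rw [← hω] at hx0
  match k, hk, he with
  | 0, _, he =>
    rw [List.eraseIdx_cons_zero, wordProd_cons, ← hω, mul_right_inj] at he
    rw [he] at hl
    omega
  | 1, _, he =>
    rw [List.eraseIdx_cons_succ, List.eraseIdx_cons_zero, wordProd_cons, ← hω, hx, ← hb,
      mul_right_inj, ← mul_assoc, mul_eq_right] at he
    exact absurd (by simpa using (mul_eq_one_iff_eq_inv.1 he).symm) hne
  | k + 2, hk, he =>
    rw [List.eraseIdx_cons_succ, List.eraseIdx_cons_succ, wordProd_cons, wordProd_cons] at he
    have hk' : k < ω.length := by simpa using hk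
    have hy : w = cs.simple j * (cs.simple i * (cs.simple j * cs.wordProd (ω.eraseIdx k))) := by
      rw [← he, simple_mul_simple_cancel_left]
    refine ⟨_, hy.trans (hb _).symm, ?_⟩
    have h1 := cs.length_wordProd_le (ω.eraseIdx k)
    rw [List.length_eraseIdx_of_lt hk'] at h1
    have h4 := cs.length_simple_mul
      (cs.simple i * (cs.simple j * cs.wordProd (ω.eraseIdx k))) j
    have h5 := cs.length_simple_mul (cs.simple j * cs.wordProd (ω.eraseIdx k)) i
    have h6 := cs.length_simple_mul (cs.wordProd (ω.eraseIdx k)) j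
    rw [← hy] at h4
    omega

/-! ### Matsumoto's theorem -/

/-- A family of elements of a monoid satisfying the simply laced braid relations. -/
structure IsBraidFamily {N : Type*} [Monoid N] (M : CoxeterMatrix I) (f : I → N) : Prop where
  comm : ∀ i j, M i j = 2 → f i * f j = f j * f i
  braid : ∀ i j, M i j = 3 → f i * (f j * f i) = f j * (f i * f j)

/-- **Matsumoto's theorem** in the simply laced case. -/
theorem IsReduced.prod_map_eq (hM : ∀ i j : I, i ≠ j → M i j = 2 ∨ M i j = 3)
    {N : Type*} [Monoid N] {f : I → N} (hf : IsBraidFamily M f) {l l' : List I}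
    (hl : cs.IsReduced l) (hl' : cs.IsReduced l') (h : cs.wordProd l = cs.wordProd l') :
    (l.map f).prod = (l'.map f).prod := by
  induction hn : l.length using Nat.strong_induction_on generalizing l l' with
  | _ n ih =>
  have hlen : l.length = l'.length := by rw [← hl.eq, ← hl'.eq, h]
  match l, l', hl, hl', h, hn, hlen with
  | [], [], _, _, _, _, _ => rfl
  | i :: r, j :: r', hl, hl', h, hn, hlen =>
    have hr : cs.IsReduced r := by simpa using hl.drop 1
    have hr' : cs.IsReduced r' := by simpa using hl'.drop 1
    have hlr : r.length < n := by simp at hn; omega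
    have hlr' : r'.length < n := by simp at hn hlen; omega
    simp only [List.map_cons, List.prod_cons]
    by_cases hij : i = j
    · subst hij
      rw [wordProd_cons, wordProd_cons, mul_right_inj] at h
      rw [ih _ hlr hr hr' h rfl]
    · set w := cs.wordProd (i :: r) with hw
      have hwl : cs.length w = r.length + 1 := by simpa using hl.eq
      have hwi : cs.simple i * w = cs.wordProd r := by
        rw [hw, wordProd_cons, simple_mul_simple_cancel_left]
      have hwj : cs.simple j * w = cs.wordProd r' := by
        rw [h, wordProd_cons, simple_mul_simple_cancel_left]
      have hlen' : r.length = r'.length := by simpa using hlen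
      have hdi : cs.IsLeftDescent w i := by
        unfold IsLeftDescent; rw [hwi, hr.eq]; omega
      have hdj : cs.IsLeftDescent w j := by
        unfold IsLeftDescent; rw [hwj, hr'.eq]; omega
      rcases hM i j hij with h2 | h3
      · obtain ⟨x, hx, hxl⟩ := cs.exists_eq_simple_mul_simple_mul hM hij hdi hdj
        obtain ⟨u, hu, rfl⟩ := cs.exists_isReduced x
        have hc : cs.simple j * (cs.simple i * cs.wordProd u) =
            cs.simple i * (cs.simple j * cs.wordProd u) := by
          have := cs.simple_comm h2
          rw [← mul_assoc, ← this, mul_assoc]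
        have e1 : cs.wordProd r = cs.wordProd (j :: u) := by
          rw [← hwi, hx, hc, simple_mul_simple_cancel_left, wordProd_cons]
        have e2 : cs.wordProd r' = cs.wordProd (i :: u) := by
          rw [← hwj, hx, simple_mul_simple_cancel_left, wordProd_cons]
        have q := hu.eq
        have q1 : cs.IsReduced (j :: u) := by
          unfold IsReduced; rw [← e1, hr.eq, List.length_cons]; omega
        have q2 : cs.IsReduced (i :: u) := by
          unfold IsReduced; rw [← e2, hr'.eq, List.length_cons]; omega
        rw [ih _ hlr hr q1 e1 rfl, ih _ hlr' hr' q2 e2 rfl]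
        simp only [List.map_cons, List.prod_cons]
        rw [← mul_assoc, hf.comm i j h2, mul_assoc]
      · obtain ⟨x, hx, hxl⟩ := cs.exists_eq_simple_mul_simple_mul_simple_mul hM hij h3 hdi hdj
        obtain ⟨u, hu, rfl⟩ := cs.exists_isReduced x
        have e1 : cs.wordProd r = cs.wordProd (j :: i :: u) := by
          rw [← hwi, hx, simple_mul_simple_cancel_left, wordProd_cons, wordProd_cons]
        have e2 : cs.wordProd r' = cs.wordProd (i :: j :: u) := by
          rw [← hwj, hx, cs.simple_braid h3, simple_mul_simple_cancel_left, wordProd_cons,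
            wordProd_cons]
        have q := hu.eq
        have q1 : cs.IsReduced (j :: i :: u) := by
          unfold IsReduced; rw [← e1, hr.eq, List.length_cons, List.length_cons]; omega
        have q2 : cs.IsReduced (i :: j :: u) := by
          unfold IsReduced; rw [← e2, hr'.eq, List.length_cons, List.length_cons]; omega
        rw [ih _ hlr hr q1 e1 rfl, ih _ hlr' hr' q2 e2 rfl]
        simp only [List.map_cons, List.prod_cons]
        have := congrArg (· * (u.map f).prod) (hf.braid i j h3)
        simpa only [mul_assoc] using this

end CoxeterSystem

section TropicalMonoid

open CoxeterSystem
open scoped Pointwise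

variable {I W : Type*} [Group W] {M : CoxeterMatrix I} {K : AddSubgroup ℝ}

theorem kmin_self (a : K) : kmin a a = a := by simp [kmin]

theorem kmin_eq_left {a b : K} (h : (a : ℝ) ≤ b) : kmin a b = a := if_pos h

theorem kmin_eq_right {a b : K} (h : (b : ℝ) ≤ a) : kmin a b = b := by
  unfold kmin
  split_ifs with h'
  · exact Subtype.ext (le_antisymm h' h)
  · rfl

theorem genU_mul_genU_of_eq_two {i j : I} (h : M i j = 2) (a b : K) :
    genU M K i a * genU M K j b = genU M K j b * genU M K i a :=
  (Con.eq _).2 (ConGen.Rel.of _ _ (UKRel.comm i j h a b))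

theorem genU_mul_genU_mul_genU {i j : I} (h : M i j = 3) (a b c : K) :
    genU M K i a * (genU M K j b * genU M K i c) =
      genU M K j (b + c - kmin a c) * (genU M K i (kmin a c) * genU M K j (a + b - kmin a c)) := by
  rw [← mul_assoc, ← mul_assoc]
  exact (Con.eq _).2 (ConGen.Rel.of _ _ (UKRel.braid i j h a b c))

theorem genU_mul_genU_self (i : I) (a b : K) :
    genU M K i a * genU M K i b = genU M K i (kmin a b) :=
  (Con.eq _).2 (ConGen.Rel.of _ _ (UKRel.idem i a b))

theorem genU_mul_genU_mul_genU_of_le {i j : I} (h : M i j = 3) {a c : K} (hca : (c : ℝ) ≤ a) :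
    genU M K i c * (genU M K j c * genU M K i a) =
      genU M K j a * (genU M K i c * genU M K j c) := by
  rw [genU_mul_genU_mul_genU h, kmin_eq_left hca]
  simp

theorem isBraidFamily_genU_const (c : K) : IsBraidFamily M fun i => genU M K i c where
  comm _ _ h := genU_mul_genU_of_eq_two h c c
  braid _ _ h := genU_mul_genU_mul_genU_of_le h le_rfl

theorem isBraidFamily_range_genU : IsBraidFamily M fun i => Set.range (genU M K i) where
  comm i j h := by
    rw [← Set.image2_mul, ← Set.image2_mul]
    ext u
    simp only [Set.mem_image2, Set.mem_range, exists_exists_eq_and]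
    constructor
    · rintro ⟨a, b, rfl⟩
      exact ⟨b, a, (genU_mul_genU_of_eq_two h a b).symm⟩
    · rintro ⟨b, a, rfl⟩
      exact ⟨a, b, genU_mul_genU_of_eq_two h a b⟩
  braid i j h := by
    have key : ∀ i j, M i j = 3 →
        Set.range (genU M K i) * (Set.range (genU M K j) * Set.range (genU M K i)) ⊆
          Set.range (genU M K j) * (Set.range (genU M K i) * Set.range (genU M K j)) := by
      intro i j h
      rintro _ ⟨_, ⟨a, rfl⟩, _, ⟨_, ⟨b, rfl⟩, _, ⟨c, rfl⟩, rfl⟩, rfl⟩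
      simp only [genU_mul_genU_mul_genU h]
      exact Set.mul_mem_mul ⟨_, rfl⟩ (Set.mul_mem_mul ⟨_, rfl⟩ ⟨_, rfl⟩)
    exact (key i j h).antisymm (key j i (by rw [M.symmetric, h]))

theorem mem_prod_range_genU_iff {l : List I} {u : UK M K} :
    u ∈ (l.map fun i => Set.range (genU M K i)).prod ↔
      ∃ ω : List (I × K), ω.map Prod.fst = l ∧ u = prodU M K ω := by
  induction l generalizing u with
  | nil => simp [prodU]
  | cons i l ih =>
    simp only [List.map_cons, List.prod_cons, Set.mem_mul, ih]
    constructor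
    · rintro ⟨_, ⟨a, rfl⟩, _, ⟨ω, rfl, rfl⟩, rfl⟩
      exact ⟨(i, a) :: ω, rfl, by simp [prodU]⟩
    · rintro ⟨ω, hω, rfl⟩
      cases ω with
      | nil => simp at hω
      | cons p ω =>
        obtain ⟨rfl, rfl⟩ := List.cons.inj hω
        exact ⟨_, ⟨p.2, rfl⟩, _, ⟨ω, rfl, rfl⟩, by simp [prodU]⟩

variable (cs : CoxeterSystem M W)

theorem isRedWord_iff {w : W} {l : List I} :
    IsRedWord cs w l ↔ cs.IsReduced l ∧ cs.wordProd l = w := by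
  unfold IsRedWord CoxeterSystem.IsReduced
  constructor
  · rintro ⟨rfl, h⟩
    exact ⟨h.symm, rfl⟩
  · rintro ⟨h, rfl⟩
    exact ⟨rfl, h.symm⟩

theorem exists_isRedWord (w : W) : ∃ l, IsRedWord cs w l := by
  obtain ⟨l, hl, h⟩ := cs.exists_isReduced w
  exact ⟨l, (isRedWord_iff cs).2 ⟨hl, h.symm⟩⟩

theorem IsRedWord.cons {w : W} {l : List I} (h : IsRedWord cs w l) {i : I}
    (hi : cs.length (cs.simple i * w) = cs.length w + 1) :
    IsRedWord cs (cs.simple i * w) (i :: l) :=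
  ⟨by rw [CoxeterSystem.wordProd_cons, h.1], by rw [List.length_cons, h.2, hi]⟩

theorem IsRedWord.concat {w : W} {l : List I} (h : IsRedWord cs w l) {i : I}
    (hi : cs.length (w * cs.simple i) = cs.length w + 1) :
    IsRedWord cs (w * cs.simple i) (l ++ [i]) :=
  ⟨by rw [CoxeterSystem.wordProd_append, h.1, CoxeterSystem.wordProd_singleton],
    by rw [List.length_append, h.2, hi, List.length_singleton]⟩

/-- The product over a reduced word of `w` with all exponents equal to `c`. -/
noncomputable def constU (c : K) (w : W) : UK M K :=
  ((exists_isRedWord cs w).choose.map fun i => genU M K i c).prod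

theorem IsRedWord.constU_eq (hM : ∀ i j : I, i ≠ j → M i j = 2 ∨ M i j = 3) (c : K) {w : W}
    {l : List I} (h : IsRedWord cs w l) :
    constU cs c w = (l.map fun i => genU M K i c).prod := by
  have h' := (isRedWord_iff cs).1 (exists_isRedWord cs w).choose_spec
  have h'' := (isRedWord_iff cs).1 h
  exact IsReduced.prod_map_eq cs hM (isBraidFamily_genU_const c) h'.1 h''.1 (h'.2.trans h''.2.symm)

theorem constU_mul_simple (hM : ∀ i j : I, i ≠ j → M i j = 2 ∨ M i j = 3) (c : K) {w : W} {j : I}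
    (hj : cs.length (w * cs.simple j) = cs.length w + 1) :
    constU cs c (w * cs.simple j) = constU cs c w * genU M K j c := by
  obtain ⟨l, hl⟩ := exists_isRedWord cs w
  rw [hl.constU_eq cs hM, (hl.concat cs hj).constU_eq cs hM]
  simp

theorem constU_mul_genU_of_isRightDescent (hM : ∀ i j : I, i ≠ j → M i j = 2 ∨ M i j = 3)
    {c a : K} (hca : (c : ℝ) ≤ a) {w : W} {j : I} (hj : cs.IsRightDescent w j) :
    constU cs c w * genU M K j a = constU cs c w := by
  have h := (cs.isRightDescent_iff).1 hj
  have h' := constU_mul_simple cs hM c (w := w * cs.simple j) (j := j) (by simpa using h.symm)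
  rw [cs.simple_mul_simple_cancel_right] at h'
  rw [h', mul_assoc, genU_mul_genU_self, kmin_eq_left hca]

theorem constU_mul_genU_of_mul_simple_eq (hM : ∀ i j : I, i ≠ j → M i j = 2 ∨ M i j = 3)
    {c a : K} (hca : (c : ℝ) ≤ a) {w : W} {i j : I}
    (h : cs.simple i * w = w * cs.simple j)
    (hj : cs.length (w * cs.simple j) = cs.length w + 1) :
    constU cs c w * genU M K j a = genU M K i a * constU cs c w := by
  induction hn : cs.length w using Nat.strong_induction_on generalizing w j with
  | _ n ih =>
  by_cases hw : w = 1
  · subst hw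
    have hij : i = j := cs.simple_injective_of_simplyLaced hM (by simpa using h)
    have h1 : IsRedWord cs (1 : W) ([] : List I) := by simp [IsRedWord]
    rw [h1.constU_eq cs hM, hij]
    simp
  · obtain ⟨k, hk⟩ := cs.exists_rightDescent_of_ne_one hw
    have hjk : j ≠ k := by
      rintro rfl
      unfold CoxeterSystem.IsRightDescent at hk
      omega
    have hkl := (cs.isRightDescent_iff).1 hk
    have hdj : cs.IsLeftDescent (w * cs.simple j)⁻¹ j := by
      rw [cs.isLeftDescent_inv_iff, CoxeterSystem.IsRightDescent, cs.simple_mul_simple_cancel_right]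
      omega
    have hdk : cs.IsLeftDescent (w * cs.simple j)⁻¹ k := by
      rw [cs.isLeftDescent_inv_iff, CoxeterSystem.IsRightDescent, ← h, mul_assoc]
      have := cs.length_simple_mul (w * cs.simple k) i
      rw [h]
      omega
    rcases hM j k hjk with h2 | h3
    · have hcomm := cs.simple_comm h2
      set w' := w * cs.simple k with hw'
      have hww : w = w' * cs.simple k := by rw [hw', cs.simple_mul_simple_cancel_right]
      have hwk : cs.length (w' * cs.simple k) = cs.length w' + 1 := by rw [← hww]; omega
      have hc' : cs.simple i * w' = w' * cs.simple j := by
        rw [hw', ← mul_assoc, h, mul_assoc, mul_assoc, hcomm]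
      have hl' : cs.length (w' * cs.simple j) = cs.length w' + 1 := by
        have e : w * cs.simple j = w' * cs.simple j * cs.simple k := by
          rw [mul_assoc w', hcomm, ← mul_assoc, ← hww]
        have := cs.length_mul_simple (w' * cs.simple j) k
        have := cs.length_mul_simple w' j
        rw [← e] at *
        omega
      have := ih _ (by omega) hc' hl' rfl
      rw [hww, constU_mul_simple cs hM c hwk, mul_assoc, ← genU_mul_genU_of_eq_two h2, ← mul_assoc,
        this, mul_assoc]
    · obtain ⟨x, hx, hxl⟩ := cs.exists_eq_simple_mul_simple_mul_simple_mul hM hjk h3 hdj hdk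
      set v := x⁻¹ with hv
      rw [cs.length_inv, hj, ← cs.length_inv x, ← hv] at hxl
      have hwv : w = v * cs.simple j * cs.simple k := by
        have := congrArg (fun y => y⁻¹ * cs.simple j) hx
        simpa [mul_assoc, hv] using this
      have l1 := cs.length_mul_simple v j
      have l2 := cs.length_mul_simple (v * cs.simple j) k
      rw [← hwv] at l2
      have hk3 : M k j = 3 := by rw [M.symmetric, h3]
      have hb := cs.simple_braid h3 1
      simp only [mul_one] at hb
      have e : cs.simple i * v = v * cs.simple k := by
        have e1 : cs.simple i * (v * (cs.simple j * cs.simple k)) =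
            v * cs.simple k * (cs.simple j * cs.simple k) := by
          have := h
          rw [hwv] at this
          simp only [mul_assoc] at this ⊢
          rw [this, hb]
        rw [← mul_assoc] at e1
        exact mul_right_cancel e1
      have lv : cs.length (v * cs.simple k) = cs.length v + 1 := by
        have l3 := cs.length_mul_simple v k
        have l4 := cs.length_mul_simple (v * cs.simple k) j
        have l5 := cs.length_mul_simple (v * cs.simple k * cs.simple j) k
        have : v * cs.simple k * cs.simple j * cs.simple k = w * cs.simple j := by
          rw [hwv]
          simp only [mul_assoc, hb]
        rw [this] at l5
        omega
      have key := ih _ (by omega) e lv rfl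
      rw [hwv, constU_mul_simple cs hM c (by rw [← hwv]; omega),
        constU_mul_simple cs hM c (by omega), mul_assoc, mul_assoc,
        genU_mul_genU_mul_genU_of_le h3 hca, ← mul_assoc, key, mul_assoc, mul_assoc]

/-! ### Paths in the graph -/

theorem distLE_refl {w₀ : W} {H : UK M K} (hH : H ∈ calU M K cs w₀) :
    DistLE M K cs w₀ 0 H H :=
  ⟨fun _ => H, rfl, rfl, fun _ _ => hH, fun _ h => absurd h (Nat.not_lt_zero _)⟩

theorem distLE_one {w₀ : W} {H H' : UK M K} (hH : H ∈ calU M K cs w₀)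
    (hH' : H' ∈ calU M K cs w₀) (h : H = H' ∨ UEdge M K cs w₀ H H') :
    DistLE M K cs w₀ 1 H H' := by
  refine ⟨fun t => if t = 0 then H else H', by simp, by simp, ?_, ?_⟩
  · intro t _
    dsimp only
    split_ifs <;> assumption
  · intro t ht
    obtain rfl : t = 0 := by omega
    simpa using h

variable {cs}

theorem UEdge.symm {w₀ : W} {H H' : UK M K} (h : UEdge M K cs w₀ H H') :
    UEdge M K cs w₀ H' H := by
  obtain ⟨hne, i, b, b', ω, hω, h1, h2⟩ := h
  exact ⟨hne.symm, i, b', b, ω, hω, h2, h1⟩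

theorem DistLE.symm {w₀ : W} {k : ℕ} {H H' : UK M K} (h : DistLE M K cs w₀ k H H') :
    DistLE M K cs w₀ k H' H := by
  obtain ⟨f, h0, hk, hf, he⟩ := h
  refine ⟨fun t => f (k - t), by simpa using hk, by simpa using h0,
    fun t _ => hf _ (Nat.sub_le _ _), fun t ht => ?_⟩
  have e := he (k - (t + 1)) (by omega)
  rw [show k - (t + 1) + 1 = k - t by omega] at e
  exact e.imp Eq.symm UEdge.symm

theorem DistLE.trans {w₀ : W} {k l : ℕ} {H H' H'' : UK M K} (h : DistLE M K cs w₀ k H H')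
    (h' : DistLE M K cs w₀ l H' H'') : DistLE M K cs w₀ (k + l) H H'' := by
  obtain ⟨f, f0, fk, hf, fe⟩ := h
  obtain ⟨g, g0, gl, hg, ge⟩ := h'
  refine ⟨fun t => if t ≤ k then f t else g (t - k), by simpa using f0, ?_, ?_, ?_⟩
  · rcases Nat.eq_zero_or_pos l with rfl | hl
    · simp [fk, ← gl, g0]
    · simp [Nat.not_le.2 hl, gl]
  · intro t ht
    dsimp only
    split_ifs with h
    · exact hf t h
    · exact hg _ (by omega)
  · intro t ht
    dsimp only
    rcases lt_trichotomy t k with h | rfl | h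
    · rw [if_pos h.le, if_pos (by omega)]
      exact fe t h
    · rw [if_pos le_rfl, if_neg (by omega), fk, ← g0]
      simpa using ge 0 (by omega)
    · rw [if_neg (by omega), if_neg (by omega), show t + 1 - k = t - k + 1 by omega]
      exact ge _ (by omega)

variable (cs)

theorem exists_eq_genU_mul_of_mem_calU (hM : ∀ i j : I, i ≠ j → M i j = 2 ∨ M i j = 3)
    {w₀ : W} {i : I} (hi : cs.IsLeftDescent w₀ i) {H : UK M K} (hH : H ∈ calU M K cs w₀) :
    ∃ (a : K) (ω : List (I × K)), IsRedWord cs w₀ (i :: ω.map Prod.fst) ∧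
      H = genU M K i a * prodU M K ω := by
  obtain ⟨ω, hω, rfl⟩ := hH
  obtain ⟨l, hl⟩ := exists_isRedWord cs (cs.simple i * w₀)
  have hil := hl.cons cs (i := i) (by
    rw [cs.simple_mul_simple_cancel_left]
    exact ((cs.isLeftDescent_iff).1 hi).symm)
  rw [cs.simple_mul_simple_cancel_left] at hil
  have h1 := (isRedWord_iff cs).1 hω
  have h2 := (isRedWord_iff cs).1 hil
  have hmem := (mem_prod_range_genU_iff (K := K) (M := M)).2 ⟨ω, rfl, rfl⟩
  rw [IsReduced.prod_map_eq cs hM isBraidFamily_range_genU h1.1 h2.1 (h1.2.trans h2.2.symm),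
    mem_prod_range_genU_iff] at hmem
  obtain ⟨ω', hω', h⟩ := hmem
  cases ω' with
  | nil => simp at hω'
  | cons p ω' =>
    obtain ⟨rfl, rfl⟩ := List.cons.inj hω'
    exact ⟨p.2, ω', hil, by simpa [prodU] using h⟩

theorem distLE_genU_mul (hM : ∀ i j : I, i ≠ j → M i j = 2 ∨ M i j = 3)
    {w₀ : W} {i : I} (hi : cs.IsLeftDescent w₀ i) {H : UK M K} (hH : H ∈ calU M K cs w₀) (c : K) :
    DistLE M K cs w₀ 1 H (genU M K i c * H) ∧ genU M K i c * H ∈ calU M K cs w₀ := by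
  obtain ⟨a, ω, hω, h⟩ := exists_eq_genU_mul_of_mem_calU cs hM hi hH
  have h' : genU M K i c * H = genU M K i (kmin c a) * prodU M K ω := by
    rw [h, ← mul_assoc, genU_mul_genU_self]
  have hmem : genU M K i c * H ∈ calU M K cs w₀ :=
    ⟨(i, kmin c a) :: ω, hω, by simpa [prodU] using h'⟩
  refine ⟨distLE_one cs hH hmem ?_, hmem⟩
  by_cases heq : H = genU M K i c * H
  · exact Or.inl heq
  · exact Or.inr ⟨heq, i, a, _, ω, hω, h, h'⟩

theorem distLE_prod_mul (hM : ∀ i j : I, i ≠ j → M i j = 2 ∨ M i j = 3)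
    {w₀ : W} (hw₀ : ∀ i, cs.IsLeftDescent w₀ i) {H : UK M K} (hH : H ∈ calU M K cs w₀) (c : K)
    (l : List I) :
    DistLE M K cs w₀ l.length H ((l.map fun i => genU M K i c).prod * H) ∧
      (l.map fun i => genU M K i c).prod * H ∈ calU M K cs w₀ := by
  induction l with
  | nil => simpa using ⟨distLE_refl cs hH, hH⟩
  | cons i l ih =>
    have h := distLE_genU_mul cs hM (hw₀ i) ih.2 c
    rw [List.map_cons, List.prod_cons, mul_assoc]
    exact ⟨ih.1.trans h.1, h.2⟩

theorem simple_mul_eq_mul_simple_of_length_le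
    (hM : ∀ i j : I, i ≠ j → M i j = 2 ∨ M i j = 3) {w : W} {i j : I}
    (hi : cs.length (cs.simple i * w) = cs.length w + 1)
    (hj : cs.length (w * cs.simple j) = cs.length w + 1)
    (hij : cs.length (cs.simple i * (w * cs.simple j)) ≤ cs.length w + 1) :
    cs.simple i * w = w * cs.simple j := by
  obtain ⟨l, hl, rfl⟩ := cs.exists_isReduced w
  have hd : cs.IsLeftDescent (cs.wordProd (l ++ [j])) i := by
    rw [CoxeterSystem.wordProd_append, CoxeterSystem.wordProd_singleton, CoxeterSystem.IsLeftDescent]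
    have := cs.length_simple_mul (cs.wordProd l * cs.simple j) i
    omega
  obtain ⟨k, hk, he⟩ := IsLeftDescent.exists_eraseIdx cs hM hd
  rw [CoxeterSystem.wordProd_append, CoxeterSystem.wordProd_singleton, ← mul_assoc] at he
  rw [List.length_append, List.length_singleton] at hk
  rcases Nat.lt_succ_iff_lt_or_eq.1 hk with hk' | rfl
  · rw [List.eraseIdx_append_of_lt_length hk', CoxeterSystem.wordProd_append,
      CoxeterSystem.wordProd_singleton, mul_left_inj] at he
    have h1 := cs.length_wordProd_le (l.eraseIdx k)
    rw [← he, List.length_eraseIdx_of_lt hk', hi, hl.eq] at h1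
    omega
  · rw [List.eraseIdx_append_of_length_le le_rfl] at he
    simp only [Nat.sub_self, List.eraseIdx_cons_zero, List.append_nil] at he
    simpa using congrArg (· * cs.simple j) he

theorem constU_mul_prodU (hM : ∀ i j : I, i ≠ j → M i j = 2 ∨ M i j = 3) {w : W} {i : I}
    (hi : cs.length (cs.simple i * w) = cs.length w + 1)
    (hmax : ∀ x, cs.length x ≤ cs.length w + 1) {c : K} {ω : List (I × K)}
    (hω : ∀ p ∈ ω, (c : ℝ) ≤ p.2) :
    constU cs c w * prodU M K ω = constU cs c w ∨
      ∃ b, constU cs c w * prodU M K ω = genU M K i b * constU cs c w := by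
  induction ω with
  | nil => simp [prodU]
  | cons p ω ih =>
    have ih := ih fun q hq => hω q (List.mem_cons_of_mem _ hq)
    have hp := hω p List.mem_cons_self
    have hcons : prodU M K (p :: ω) = genU M K p.1 p.2 * prodU M K ω := by simp [prodU]
    rw [hcons, ← mul_assoc]
    rcases cs.length_mul_simple w p.1 with hj | hj
    · rw [constU_mul_genU_of_mul_simple_eq cs hM hp
        (simple_mul_eq_mul_simple_of_length_le cs hM hi hj (hmax _)) hj, mul_assoc]
      rcases ih with h | ⟨b, h⟩
      · exact Or.inr ⟨_, by rw [h]⟩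
      · exact Or.inr ⟨_, by rw [h, ← mul_assoc, genU_mul_genU_self]⟩
    · rwa [constU_mul_genU_of_isRightDescent cs hM hp ((cs.isRightDescent_iff).2 hj)]

theorem exists_forall_mem_le (ω : List (I × K)) : ∃ c : K, ∀ p ∈ ω, (c : ℝ) ≤ p.2 := by
  induction ω with
  | nil => exact ⟨0, by simp⟩
  | cons p ω ih =>
    obtain ⟨c, hc⟩ := ih
    refine ⟨min c p.2, fun q hq => ?_⟩
    rcases List.mem_cons.1 hq with rfl | hq
    · exact min_le_right c q.2
    · exact le_trans (min_le_left c p.2) (hc q hq)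

theorem distLE_one_of_isLeftDescent (hM : ∀ i j : I, i ≠ j → M i j = 2 ∨ M i j = 3)
    {w₀ : W} {i : I} (hi : cs.IsLeftDescent w₀ i) {c : K} {H H' : UK M K}
    (hH : H ∈ calU M K cs w₀) (hH' : H' ∈ calU M K cs w₀)
    (h : H = constU cs c (cs.simple i * w₀) ∨
      ∃ b, H = genU M K i b * constU cs c (cs.simple i * w₀))
    (h' : H' = constU cs c (cs.simple i * w₀) ∨
      ∃ b, H' = genU M K i b * constU cs c (cs.simple i * w₀)) :
    DistLE M K cs w₀ 1 H H' := by
  rcases h with h | ⟨b, h⟩ <;> rcases h' with h' | ⟨b', h'⟩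
  · exact distLE_one cs hH hH' (Or.inl (h.trans h'.symm))
  · rw [← h] at h'
    rw [h']
    exact (distLE_genU_mul cs hM hi hH b').1
  · rw [← h'] at h
    rw [h]
    exact (distLE_genU_mul cs hM hi hH' b).1.symm
  · refine distLE_one cs hH hH' (or_iff_not_imp_left.2 fun hne => ?_)
    obtain ⟨l, hl⟩ := exists_isRedWord cs (cs.simple i * w₀)
    have hil := hl.cons cs (i := i) (by
      rw [cs.simple_mul_simple_cancel_left]
      exact ((cs.isLeftDescent_iff).1 hi).symm)
    rw [cs.simple_mul_simple_cancel_left] at hil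
    have hprod : constU cs c (cs.simple i * w₀) = prodU M K (l.map fun k => (k, c)) := by
      rw [hl.constU_eq cs hM, prodU, List.map_map]
      rfl
    rw [hprod] at h h'
    exact ⟨hne, i, b, b', _, by simpa [Function.comp_def] using hil, h, h'⟩

end TropicalMonoid

/-- **Theorem 2(i)** (Lusztig, "Half circles on flag manifolds over a semifield").
Let `(W, (sᵢ)_{i ∈ I})` be a finite simply laced Coxeter system (`M i j ∈ {2,3}` off the
diagonal), `w₀` its longest element, `ν = ℓ(w₀)` the maximal value of the length function,
and `K ≠ 0` an additive subgroup of `ℝ`, viewed as a tropical semifield.  Then any two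
elements `H, H̃` of `𝒰(K)` are at distance `≤ 2ν - 1` in the graph on `𝒰(K)`
(equivalently, any two points of the flag manifold `ℬ_K` are at distance `≤ 2ν - 1`). -/
theorem distance_le_two_nu_sub_one
    {I W : Type*} [Finite I] [Nonempty I] [Group W] [Finite W]
    (M : CoxeterMatrix I) (hM : ∀ i j : I, i ≠ j → M i j = 2 ∨ M i j = 3)
    (cs : CoxeterSystem M W)
    (K : AddSubgroup ℝ) (hK : K ≠ ⊥)
    (ν : ℕ) (w₀ : W) (hw₀ : cs.length w₀ = ν) (hν : ∀ w : W, cs.length w ≤ ν)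
    (H H' : UK M K) (hH : H ∈ calU M K cs w₀) (hH' : H' ∈ calU M K cs w₀) :
    DistLE M K cs w₀ (2 * ν - 1) H H' := by
  have hdesc : ∀ i, cs.IsLeftDescent w₀ i := fun i => by
    have h1 := cs.length_simple_mul w₀ i
    have h2 := hν (cs.simple i * w₀)
    unfold CoxeterSystem.IsLeftDescent
    omega
  obtain ⟨i⟩ := ‹Nonempty I›
  have hi := (cs.isLeftDescent_iff).1 (hdesc i)
  have hi' : cs.length (cs.simple i * (cs.simple i * w₀)) =
      cs.length (cs.simple i * w₀) + 1 := by
    rw [cs.simple_mul_simple_cancel_left, hi]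
  obtain ⟨l, hl⟩ := exists_isRedWord cs (cs.simple i * w₀)
  obtain ⟨ω, hω, hHω⟩ := id hH
  obtain ⟨ω', hω', hHω'⟩ := id hH'
  obtain ⟨c, hc⟩ := exists_forall_mem_le (ω ++ ω')
  have hmax : ∀ x, cs.length x ≤ cs.length (cs.simple i * w₀) + 1 := fun x => by
    rw [hi, hw₀]
    exact hν x
  have hY := constU_mul_prodU cs hM hi' hmax (c := c) (ω := ω)
    fun p hp => hc p (List.mem_append_left _ hp)
  have hY' := constU_mul_prodU cs hM hi' hmax (c := c) (ω := ω')
    fun p hp => hc p (List.mem_append_right _ hp)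
  have hd := distLE_prod_mul cs hM hdesc hH c l
  have hd' := distLE_prod_mul cs hM hdesc hH' c l
  rw [← hl.constU_eq cs hM] at hd hd'
  rw [← hHω] at hY
  rw [← hHω'] at hY'
  have hmid := distLE_one_of_isLeftDescent cs hM (hdesc i) hd.2 hd'.2 hY hY'
  have hlen : 2 * ν - 1 = l.length + 1 + l.length := by
    rw [hl.2, ← hw₀]
    omega
  rw [hlen]
  exact (hd.1.trans hmid).trans hd'.1.symm
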